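/- Let β, γ > −1 with β + γ + 1 ≠ 0, let L > 0, let 1 < α < 2, let θ be a real number with |θ| ≤ min{α, 2−α}, and let j be a nonnegative integer. Then for every x ∈ (0, L), the Riesz–Feller fractional derivative of the shifted Jacobi polynomial satisfies D_θ^α J_{L,j}^{β,γ}(x) = Σ_{k=0}^{j} Σ_{i=0}^{k} Ψ_{i,j,k}^{α,β,γ}(x) · J_{L,i}^{β,γ}(x), where Ψ_{i,j,k}^{α,β,γ}(x) = −[ c₊ · Θ_{i,j,k}^{α,β,γ} · Υ_{i,k}^{β,γ} · x^{−α} + c₋ · Θ̄_{j,k}^{α,β,γ} · Ῡ_{i,k}^{β,γ} · (L−x)^{−α} ], with c₊ = sin((α−θ)π/2)/sin(απ), c₋ = sin((α+θ)π/2)/sin(απ), Θ_{i,j,k}^{α,β,γ} = (−1)^{i+j+k} Γ(1+β+γ+j+k) Γ(1+γ+j) Γ(1+k) / [Γ(1+β+γ+j) Γ(1+γ+k) Γ(1+k−α) (j−k)! k!], Υ_{i,k}^{β,γ} = (−k)_i (1+γ)_k (2+β+γ)_{i−1} (1+β+γ+2i) / [(1+γ)_i (2+β+γ)_k (2+k+β+γ)_i],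 Θ̄_{j,k}^{α,β,γ} = (−1)^{k} Γ(1+β+γ+j+k) Γ(1+β+j) Γ(1+k) / [Γ(1+β+γ+j) Γ(1+β+k) Γ(1+k−α) (j−k)! k!], and Ῡ_{i,k}^{β,γ} = (−k)_i (1+β)_k (2+β+γ)_{i−1} (1+β+γ+2i) / [(1+β)_i (2+β+γ)_k (2+k+β+γ)_i]. -/

import Mathlib

open Real Finset MeasureTheory

/-- Pochhammer's symbol `(a)_n = Γ(a+n)/Γ(a)` for real `a` and integer `n`
(in particular `(a)_{-1} = 1/(a-1)`). -/
noncomputable def poch (a : ℝ) (n : ℤ) : ℝ := Real.Gamma (a + n) / Real.Gamma a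

/-- The shifted Jacobi polynomial `J_{L,k}^{β,γ}` on `[0,L]`. -/
noncomputable def shiftedJacobi (L β γ : ℝ) (k : ℕ) (x : ℝ) : ℝ :=
  ∑ i ∈ Finset.range (k + 1),
    (-1 : ℝ) ^ (k - i) * Real.Gamma ((k : ℝ) + γ + 1) * Real.Gamma ((k : ℝ) + (i : ℝ) + β + γ + 1) /
      (Real.Gamma ((i : ℝ) + γ + 1) * Real.Gamma ((k : ℝ) + β + γ + 1) *
        (Nat.factorial (k - i) : ℝ) * (Nat.factorial i : ℝ) * L ^ i) * x ^ i

/-- The coefficient `Θ_{i,j,k}^{α,β,γ}`. -/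
noncomputable def Theta (α β γ : ℝ) (i j k : ℕ) : ℝ :=
  (-1 : ℝ) ^ (i + j + k) * Real.Gamma (1 + β + γ + (j : ℝ) + (k : ℝ)) *
      Real.Gamma (1 + γ + (j : ℝ)) * Real.Gamma (1 + (k : ℝ)) /
    (Real.Gamma (1 + β + γ + (j : ℝ)) * Real.Gamma (1 + γ + (k : ℝ)) *
      Real.Gamma (1 + (k : ℝ) - α) * (Nat.factorial (j - k) : ℝ) * (Nat.factorial k : ℝ))

/-- The coefficient `Υ_{i,k}^{β,γ}`, with `(-k)_i = (-1)^i k!/(k-i)!`. -/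
noncomputable def Upsilon (β γ : ℝ) (i k : ℕ) : ℝ :=
  ((-1 : ℝ) ^ i * (Nat.factorial k : ℝ) / (Nat.factorial (k - i) : ℝ)) * poch (1 + γ) k *
      poch (2 + β + γ) ((i : ℤ) - 1) * (1 + β + γ + 2 * (i : ℝ)) /
    (poch (1 + γ) i * poch (2 + β + γ) k * poch (2 + (k : ℝ) + β + γ) i)

/-- The coefficient `Θ̄_{j,k}^{α,β,γ}`. -/
noncomputable def ThetaBar (α β γ : ℝ) (j k : ℕ) : ℝ :=
  (-1 : ℝ) ^ k * Real.Gamma (1 + β + γ + (j : ℝ) + (k : ℝ)) *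
      Real.Gamma (1 + β + (j : ℝ)) * Real.Gamma (1 + (k : ℝ)) /
    (Real.Gamma (1 + β + γ + (j : ℝ)) * Real.Gamma (1 + β + (k : ℝ)) *
      Real.Gamma (1 + (k : ℝ) - α) * (Nat.factorial (j - k) : ℝ) * (Nat.factorial k : ℝ))

/-- The coefficient `Ῡ_{i,k}^{β,γ}`, with `(-k)_i = (-1)^i k!/(k-i)!`. -/
noncomputable def UpsilonBar (β γ : ℝ) (i k : ℕ) : ℝ :=
  ((-1 : ℝ) ^ i * (Nat.factorial k : ℝ) / (Nat.factorial (k - i) : ℝ)) * poch (1 + β) k *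
      poch (2 + β + γ) ((i : ℤ) - 1) * (1 + β + γ + 2 * (i : ℝ)) /
    (poch (1 + β) i * poch (2 + β + γ) k * poch (2 + (k : ℝ) + β + γ) i)

/-- The coefficient `Ψ_{i,j,k}^{α,β,γ}(x)` appearing in the Riesz–Feller fractional
derivative of the shifted Jacobi polynomial, where `c₊ = sin((α-θ)π/2)/sin(απ)` and
`c₋ = sin((α+θ)π/2)/sin(απ)`. -/
noncomputable def Psi (L α θ β γ : ℝ) (i j k : ℕ) (x : ℝ) : ℝ :=
  -((Real.sin ((α - θ) * Real.pi / 2) / Real.sin (α * Real.pi)) *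
        Theta α β γ i j k * Upsilon β γ i k * x ^ (-α)
    + (Real.sin ((α + θ) * Real.pi / 2) / Real.sin (α * Real.pi)) *
        ThetaBar α β γ j k * UpsilonBar β γ i k * (L - x) ^ (-α))

lemma intervalIntegrable_sub_rpow_mul_pow {α : ℝ} (hα : α < 2) (y : ℝ) (k : ℕ) :
    IntervalIntegrable (fun ξ : ℝ => (y - ξ) ^ (1 - α) * ξ ^ k) volume 0 y := by
  have h : IntervalIntegrable (fun ξ : ℝ => ξ ^ (1 - α)) volume 0 y :=
    intervalIntegral.intervalIntegrable_rpow' (r := 1 - α) (by linarith)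
  have h' := h.comp_sub_left y
  simp only [sub_zero, sub_self] at h'
  exact h'.symm.mul_continuousOn (by fun_prop)

lemma integral_sub_rpow_mul_pow {α : ℝ} (hα : α < 2) {y : ℝ} (hy : 0 < y) (k : ℕ) :
    ∫ ξ in (0:ℝ)..y, (y - ξ) ^ (1 - α) * ξ ^ k =
      (k.factorial : ℝ) * Real.Gamma (2 - α) / Real.Gamma (k + 3 - α) * y ^ (k + 2 - α) := by
  have hk : (0 : ℝ) ≤ k := k.cast_nonneg
  have hG : Real.Gamma ((k + 1 : ℝ) + (2 - α)) ≠ 0 :=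
    (Real.Gamma_pos_of_pos (by linarith)).ne'
  have hbeta : Complex.betaIntegral ((k + 1 : ℝ) : ℂ) ((2 - α : ℝ) : ℂ) =
      ((k.factorial * Real.Gamma (2 - α) / Real.Gamma (k + 3 - α) : ℝ) : ℂ) := by
    have h := Complex.Gamma_mul_Gamma_eq_betaIntegral (s := ((k + 1 : ℝ) : ℂ))
      (t := ((2 - α : ℝ) : ℂ)) (by rw [Complex.ofReal_re]; linarith)
      (by rw [Complex.ofReal_re]; linarith)
    rw [← Complex.ofReal_add, Complex.Gamma_ofReal, Complex.Gamma_ofReal, Complex.Gamma_ofReal,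
      Real.Gamma_nat_eq_factorial] at h
    have hG' : ((Real.Gamma ((k + 1 : ℝ) + (2 - α)) : ℝ) : ℂ) ≠ 0 := Complex.ofReal_ne_zero.2 hG
    rw [show (k : ℝ) + 3 - α = (k + 1 : ℝ) + (2 - α) by ring, Complex.ofReal_div,
      Complex.ofReal_mul, eq_div_iff hG', h, mul_comm]
  have hscaled := Complex.betaIntegral_scaled ((k + 1 : ℝ) : ℂ) ((2 - α : ℝ) : ℂ) hy
  apply Complex.ofReal_injective
  rw [← intervalIntegral.integral_ofReal, Complex.ofReal_mul, ← hbeta,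
    Complex.ofReal_cpow hy.le, mul_comm]
  convert hscaled using 1
  · refine intervalIntegral.integral_congr fun ξ hξ => ?_
    rw [Set.uIcc_of_le hy.le] at hξ
    rw [Complex.ofReal_mul, Complex.ofReal_cpow (sub_nonneg.2 hξ.2), mul_comm]
    congr 1
    · rw [show (((k + 1 : ℝ) : ℂ) - 1) = (k : ℂ) by push_cast; ring, Complex.cpow_natCast]
      push_cast; rfl
    · push_cast
      congr 1
      ring
  · congr 2
    push_cast
    ring

lemma iteratedDeriv_two_rpow (p : ℝ) {x : ℝ} (hx : 0 < x) :
    iteratedDeriv 2 (fun y : ℝ => y ^ p) x = p * (p - 1) * x ^ (p - 2) := by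
  have h : deriv (fun y : ℝ => y ^ p) =ᶠ[nhds x] fun y => p * y ^ (p - 1) := by
    filter_upwards [lt_mem_nhds hx] with y hy
    exact Real.deriv_rpow_const y p
  rw [iteratedDeriv_succ, iteratedDeriv_one, h.deriv_eq, deriv_const_mul_field,
    Real.deriv_rpow_const]
  ring_nf

/-- The left-sided Riemann–Liouville derivative of order `α ∈ (1, 2)` of a polynomial. -/
lemma iteratedDeriv_two_integral_sub_rpow_mul_sum {α : ℝ} (hα2 : α < 2)
    (hα1 : 1 < α) (a : ℕ → ℝ) (n : ℕ) {x : ℝ} (hx : 0 < x) :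
    iteratedDeriv 2 (fun y : ℝ => (1 / Real.Gamma (2 - α)) *
      ∫ ξ in (0:ℝ)..y, (y - ξ) ^ (1 - α) * ∑ k ∈ range n, a k * ξ ^ k) x =
    ∑ k ∈ range n, a k * (k.factorial / Real.Gamma (1 + k - α)) * x ^ (-α) * x ^ k := by
  have hev : (fun y : ℝ => (1 / Real.Gamma (2 - α)) *
      ∫ ξ in (0:ℝ)..y, (y - ξ) ^ (1 - α) * ∑ k ∈ range n, a k * ξ ^ k) =ᶠ[nhds x]
      fun y => ∑ k ∈ range n,
        (a k * (k.factorial / Real.Gamma (k + 3 - α))) * y ^ ((k : ℝ) + 2 - α) := by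
    filter_upwards [lt_mem_nhds hx] with y hy
    have hG : Real.Gamma (2 - α) ≠ 0 := (Real.Gamma_pos_of_pos (by linarith)).ne'
    have : ∀ ξ : ℝ, (y - ξ) ^ (1 - α) * ∑ k ∈ range n, a k * ξ ^ k =
        ∑ k ∈ range n, a k * ((y - ξ) ^ (1 - α) * ξ ^ k) := fun ξ => by
      rw [mul_sum]
      exact sum_congr rfl fun k _ => by ring
    simp only [this]
    rw [intervalIntegral.integral_finsetSum fun k _ =>
      (intervalIntegrable_sub_rpow_mul_pow hα2 y k).const_mul (a k), mul_sum]
    refine sum_congr rfl fun k _ => ?_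
    rw [intervalIntegral.integral_const_mul, integral_sub_rpow_mul_pow hα2 hy]
    field_simp
  rw [hev.iteratedDeriv_eq 2, iteratedDeriv_fun_sum fun k _ =>
    contDiffAt_const.mul (Real.contDiffAt_rpow_const_of_ne hx.ne')]
  refine sum_congr rfl fun k _ => ?_
  have hk : (0 : ℝ) ≤ k := k.cast_nonneg
  rw [iteratedDeriv_const_mul_field, iteratedDeriv_two_rpow _ hx,
    show (k : ℝ) + 2 - α - 2 = -α + k by ring, Real.rpow_add_natCast hx.ne',
    show (k : ℝ) + 3 - α = (1 + k - α) + 1 + 1 by ring,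
    Real.Gamma_add_one (s := 1 + k - α + 1) (by linarith)]
  rcases eq_or_ne (1 + k - α) 0 with h0 | h0
  · rcases k with _ | k
    · norm_num at h0; linarith
    · push_cast at h0
      have : (0 : ℝ) ≤ k := k.cast_nonneg
      linarith
  · have h1 : 1 + k - α + 1 ≠ 0 := by linarith
    rw [Real.Gamma_add_one h0]
    have e1 : (k : ℝ) + 2 - α = 1 + k - α + 1 := by ring
    have e2 : (k : ℝ) + 2 - α - 1 = 1 + k - α := by ring
    rw [e2, e1]
    by_cases hg : Real.Gamma (1 + k - α) = 0
    · simp [hg]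
    · field_simp

lemma sum_range_alternating_choose_succ (g : ℕ → ℝ) (n : ℕ) :
    ∑ s ∈ range (n + 2), (-1 : ℝ) ^ s * ((n + 1).choose s) * g s =
      ∑ s ∈ range (n + 1), (-1 : ℝ) ^ s * (n.choose s) * g s -
        ∑ s ∈ range (n + 1), (-1 : ℝ) ^ s * (n.choose s) * g (s + 1) := by
  have h : ∑ s ∈ range (n + 1), (-1 : ℝ) ^ s * (n.choose s) * g s =
      ∑ s ∈ range (n + 1), (-1 : ℝ) ^ (s + 1) * (n.choose (s + 1)) * g (s + 1) + g 0 := by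
    have := sum_range_succ (fun s => (-1 : ℝ) ^ s * (n.choose s) * g s) (n + 1)
    rw [sum_range_succ' _ (n + 1)] at this
    simpa using this.symm
  rw [h, sum_range_succ', add_sub_right_comm, ← sum_sub_distrib]
  congr 1
  · refine sum_congr rfl fun s _ => ?_
    rw [Nat.choose_succ_succ]
    push_cast
    ring
  · simp

/-- The Chu–Vandermonde summation, in terms of the Gamma function. -/
lemma sum_range_alternating_choose_mul_Gamma_div (n : ℕ) {e f : ℝ} (he : -1 < e) (he0 : e ≠ 0)
    (hf : 0 < f) :
    ∑ s ∈ range (n + 1), (-1 : ℝ) ^ s * (n.choose s) * (Real.Gamma (e + s) / Real.Gamma (f + s)) =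
      Real.Gamma e / Real.Gamma (f + n) * ∏ l ∈ range n, (f - e + l) := by
  induction n generalizing e f with
  | zero => simp
  | succ n ih =>
    have hn : (0 : ℝ) ≤ n := n.cast_nonneg
    rw [sum_range_alternating_choose_succ (fun s => Real.Gamma (e + s) / Real.Gamma (f + s)),
      ih he he0 hf]
    have h := ih (e := e + 1) (f := f + 1) (by linarith) (by linarith) (by linarith)
    have h' : ∑ s ∈ range (n + 1), (-1 : ℝ) ^ s * (n.choose s) *
        (Real.Gamma (e + (s + 1 : ℕ)) / Real.Gamma (f + (s + 1 : ℕ))) =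
        Real.Gamma (e + 1) / Real.Gamma (f + 1 + n) * ∏ l ∈ range n, (f + 1 - (e + 1) + l) := by
      rw [← h]
      refine sum_congr rfl fun s _ => ?_
      push_cast
      ring_nf
    rw [h', Real.Gamma_add_one he0, show f + 1 + n = f + n + 1 by ring, prod_range_succ,
      show f + ((n + 1 : ℕ) : ℝ) = f + n + 1 by push_cast; ring,
      Real.Gamma_add_one (s := f + n) (by linarith), add_sub_add_right_eq_sub]
    have hG := (Real.Gamma_pos_of_pos (s := f + n) (by linarith)).ne'
    have h0 : f + n ≠ 0 := by linarith
    field_simp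
    ring

lemma prod_range_sub_eq_Gamma_div (n : ℕ) {g : ℝ} (hg : 0 < g) :
    ∏ l ∈ range n, (-(g + n) + 1 + l) = (-1 : ℝ) ^ n * (Real.Gamma (g + n) / Real.Gamma g) := by
  induction n with
  | zero => simp [(Real.Gamma_pos_of_pos hg).ne']
  | succ n ih =>
    have hn : (0 : ℝ) ≤ n := n.cast_nonneg
    rw [prod_range_succ']
    have : ∀ l ∈ range n, -(g + ((n + 1 : ℕ) : ℝ)) + 1 + ((l + 1 : ℕ) : ℝ) = -(g + n) + 1 + l :=
      fun l _ => by push_cast; ring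
    rw [prod_congr rfl this, ih, show g + ((n + 1 : ℕ) : ℝ) = g + n + 1 by push_cast; ring,
      Real.Gamma_add_one (s := g + n) (by linarith)]
    push_cast
    ring

/-- The orthogonality relation behind the inversion of the Jacobi coefficients. -/
lemma sum_range_alternating_choose_mul_Gamma_telescope {n : ℕ} (hn : n ≠ 0) {d : ℝ} (hd : -1 < d)
    (hd0 : d ≠ 0) :
    ∑ s ∈ range (n + 1), (-1 : ℝ) ^ s * (n.choose s) *
      ((d + 2 * s) * Real.Gamma (d + s) / Real.Gamma (d + n + s + 1)) = 0 := by
  have hn1 : (1 : ℝ) ≤ n := by exact_mod_cast Nat.one_le_iff_ne_zero.2 hn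
  have hn0 : (n : ℝ) ≠ 0 := by linarith
  set G : ℕ → ℝ := fun s => -((-1 : ℝ) ^ s * s * (n.choose s) *
    (Real.Gamma (d + s) / Real.Gamma (d + n + s))) / n with hG
  have key : ∀ s ∈ range (n + 1), (-1 : ℝ) ^ s * (n.choose s) *
      ((d + 2 * s) * Real.Gamma (d + s) / Real.Gamma (d + n + s + 1)) = G (s + 1) - G s := by
    intro s hs
    have hs0 : (0 : ℝ) ≤ s := s.cast_nonneg
    have hsn : s ≤ n := by simpa [Nat.lt_succ_iff] using hs
    have hds : d + s ≠ 0 := by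
      rcases s with _ | s
      · simpa using hd0
      · have : (0 : ℝ) ≤ s := s.cast_nonneg
        push_cast; linarith
    have hdn : d + n + s ≠ 0 := by linarith
    have hGp := (Real.Gamma_pos_of_pos (s := d + n + s) (by linarith)).ne'
    have hch : ((n.choose (s + 1) : ℕ) : ℝ) * (s + 1) = n.choose s * (n - s) := by
      have := Nat.choose_succ_right_eq n s
      rw [← Nat.cast_sub hsn]
      exact_mod_cast this
    simp only [hG]
    rw [show d + ((s + 1 : ℕ) : ℝ) = d + s + 1 by push_cast; ring,
      show d + n + ((s + 1 : ℕ) : ℝ) = d + n + s + 1 by push_cast; ring,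
      Real.Gamma_add_one hds, Real.Gamma_add_one hdn]
    push_cast
    rw [pow_succ]
    have e : (-1 : ℝ) ^ s * -1 * (s + 1) * (n.choose (s + 1)) =
      -((-1 : ℝ) ^ s) * (n.choose s * (n - s)) := by rw [← hch]; ring
    rw [e]
    field_simp
    ring
  rw [sum_congr rfl key, sum_range_sub]
  simp [hG]

lemma sum_range_sum_range_eq_sum_range_add (n : ℕ) (f : ℕ → ℕ → ℝ) :
    ∑ i ∈ range (n + 1), ∑ m ∈ range (i + 1), f i m =
      ∑ m ∈ range (n + 1), ∑ s ∈ range (n - m + 1), f (m + s) m := by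
  have h := sum_Ico_Ico_comm 0 (n + 1) (fun m i => f i m)
  simp only [← range_eq_Ico] at h
  rw [← h]
  refine sum_congr rfl fun m hm => ?_
  rw [sum_Ico_eq_sum_range, Nat.sub_add_comm (by simpa [Nat.lt_succ_iff] using hm)]

lemma Gamma_add_natCast_ne_zero {c : ℝ} (hc : -1 < c) (hc0 : c ≠ 0) (n : ℕ) :
    Real.Gamma (c + n) ≠ 0 := by
  rcases n with _ | n
  · have h := Real.Gamma_add_one hc0
    have h1 : Real.Gamma (c + 1) ≠ 0 := (Real.Gamma_pos_of_pos (by linarith)).ne'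
    rw [h] at h1
    simpa using right_ne_zero_of_mul h1
  · have : (0 : ℝ) ≤ n := n.cast_nonneg
    exact (Real.Gamma_pos_of_pos (by push_cast; linarith)).ne'

lemma Upsilon_eq {β γ : ℝ} (hβ : -1 < β) (hγ : -1 < γ) (i k : ℕ) :
    Upsilon β γ i k = (-1 : ℝ) ^ i * k.factorial / (k - i).factorial *
      (Real.Gamma (γ + 1 + k) * Real.Gamma (β + γ + 1 + i) * (β + γ + 1 + 2 * i)) /
      (Real.Gamma (γ + 1 + i) * Real.Gamma (β + γ + 1 + k + i + 1)) := by
  have hk : (0 : ℝ) ≤ k := k.cast_nonneg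
  have hi : (0 : ℝ) ≤ i := i.cast_nonneg
  have h1 := (Real.Gamma_pos_of_pos (s := γ + 1) (by linarith)).ne'
  have h2 := (Real.Gamma_pos_of_pos (s := β + γ + 2) (by linarith)).ne'
  have h3 := (Real.Gamma_pos_of_pos (s := γ + 1 + i) (by linarith)).ne'
  have h4 := (Real.Gamma_pos_of_pos (s := β + γ + 2 + k) (by linarith)).ne'
  have h5 := (Real.Gamma_pos_of_pos (s := β + γ + 1 + k + i + 1) (by linarith)).ne'
  have h6 : ((k - i).factorial : ℝ) ≠ 0 := by positivity
  simp only [Upsilon, poch]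
  push_cast
  rw [show 1 + γ + (k : ℝ) = γ + 1 + k by ring, show 1 + γ + (i : ℝ) = γ + 1 + i by ring,
    show 1 + γ = γ + 1 by ring, show 2 + β + γ + ((i : ℝ) - 1) = β + γ + 1 + i by ring,
    show 2 + β + γ + (k : ℝ) = β + γ + 2 + k by ring,
    show 2 + (k : ℝ) + β + γ + i = β + γ + 1 + k + i + 1 by ring,
    show 2 + (k : ℝ) + β + γ = β + γ + 2 + k by ring, show 2 + β + γ = β + γ + 2 by ring,
    show 1 + β + γ + 2 * (i : ℝ) = β + γ + 1 + 2 * i by ring]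
  field_simp

lemma cast_choose_add (s t : ℕ) :
    (((s + t).choose s : ℕ) : ℝ) = (s + t).factorial / (s.factorial * t.factorial) := by
  rw [Nat.cast_add_choose]

/-- The expansion of a monomial in shifted Jacobi polynomials. -/
lemma sum_Upsilon_mul_shiftedJacobi {β γ L : ℝ} (hβ : -1 < β) (hγ : -1 < γ)
    (hbg : β + γ + 1 ≠ 0) (hL : L ≠ 0) (k : ℕ) (x : ℝ) :
    ∑ i ∈ range (k + 1), (-1 : ℝ) ^ i * Upsilon β γ i k * shiftedJacobi L β γ i x =
      (x / L) ^ k := by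
  simp only [shiftedJacobi, mul_sum]
  rw [sum_range_sum_range_eq_sum_range_add]
  have hterm : ∀ m ∈ range (k + 1),
      ∑ s ∈ range (k - m + 1), (-1 : ℝ) ^ (m + s) * Upsilon β γ (m + s) k *
        ((-1 : ℝ) ^ (m + s - m) * Real.Gamma (((m + s : ℕ) : ℝ) + γ + 1) *
          Real.Gamma (((m + s : ℕ) : ℝ) + (m : ℝ) + β + γ + 1) /
          (Real.Gamma ((m : ℝ) + γ + 1) * Real.Gamma (((m + s : ℕ) : ℝ) + β + γ + 1) *
          (Nat.factorial (m + s - m) : ℝ) * (Nat.factorial m : ℝ) * L ^ m) * x ^ m) =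
      Real.Gamma (γ + 1 + k) * k.factorial /
        (Real.Gamma (m + γ + 1) * m.factorial * (k - m).factorial) * (x / L) ^ m *
      ∑ s ∈ range (k - m + 1), (-1 : ℝ) ^ s * ((k - m).choose s) *
        ((β + γ + 1 + 2 * m + 2 * s) * Real.Gamma (β + γ + 1 + 2 * m + s) /
          Real.Gamma (β + γ + 1 + 2 * m + (k - m : ℕ) + s + 1)) := by
    intro m hm
    obtain ⟨n, rfl⟩ := Nat.exists_eq_add_of_le (Nat.lt_succ_iff.1 (mem_range.1 hm))
    rw [Nat.add_sub_cancel_left, mul_sum]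
    refine sum_congr rfl fun s hs => ?_
    obtain ⟨t, rfl⟩ := Nat.exists_eq_add_of_le (Nat.lt_succ_iff.1 (mem_range.1 hs))
    have hm0 : (0 : ℝ) ≤ m := m.cast_nonneg
    have hs0 : (0 : ℝ) ≤ s := s.cast_nonneg
    have ht0 : (0 : ℝ) ≤ t := t.cast_nonneg
    rw [Upsilon_eq hβ hγ, cast_choose_add, Nat.add_sub_cancel_left,
      show m + (s + t) - (m + s) = t by omega]
    have h1 := (Real.Gamma_pos_of_pos (s := m + γ + 1) (by linarith)).ne'
    have h2 := (Real.Gamma_pos_of_pos (s := γ + 1 + (m + s : ℕ)) (by push_cast; linarith)).ne'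
    have h3 := Gamma_add_natCast_ne_zero (c := β + γ + 1) (by linarith) hbg (m + s)
    rw [show ((m + s : ℕ) : ℝ) + γ + 1 = γ + 1 + (m + s : ℕ) by ring,
      show ((m + s : ℕ) : ℝ) + β + γ + 1 = β + γ + 1 + (m + s : ℕ) by ring,
      show ((m + s : ℕ) : ℝ) + m + β + γ + 1 = β + γ + 1 + 2 * m + s by push_cast; ring,
      show β + γ + 1 + ((m + (s + t) : ℕ) : ℝ) + (m + s : ℕ) + 1 =
        β + γ + 1 + 2 * m + (s + t : ℕ) + s + 1 by push_cast; ring]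
    have hsgn : (-1 : ℝ) ^ (m + s) * (-1 : ℝ) ^ (m + s) = 1 := by
      rw [← mul_pow]; simp
    have hc : β + γ + 1 + 2 * ((m + s : ℕ) : ℝ) = β + γ + 1 + 2 * m + 2 * s := by
      push_cast; ring
    rw [hc, div_pow]
    have h4 := (Real.Gamma_pos_of_pos (s := β + γ + 1 + 2 * m + (s + t : ℕ) + s + 1) <| by
      rcases Nat.eq_zero_or_pos (m + s) with h | h
      · have : m = 0 := by omega
        have : s = 0 := by omega
        subst_vars
        push_cast; linarith
      · push_cast; linarith).ne'
    have hL' : L ^ m ≠ 0 := pow_ne_zero _ hL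
    generalize Real.Gamma (γ + 1 + (m + s : ℕ)) = G2 at *
    generalize Real.Gamma (β + γ + 1 + (m + s : ℕ)) = G3 at *
    generalize Real.Gamma (β + γ + 1 + 2 * m + (s + t : ℕ) + s + 1) = G4 at *
    generalize Real.Gamma (m + γ + 1) = G1 at *
    generalize (-1 : ℝ) ^ (m + s) = e at *
    have h7 : ((s + t).factorial : ℝ) ≠ 0 := by positivity
    field_simp
    linear_combination Real.Gamma (γ + 1 + (m + (s + t) : ℕ)) * (β + γ + 1 + 2 * m + 2 * s) *
      x ^ m * Real.Gamma (β + γ + 1 + 2 * m + s) * hsgn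
  rw [sum_congr rfl hterm, sum_range_succ, sum_eq_zero, zero_add]
  · have hk0 : (0 : ℝ) ≤ k := k.cast_nonneg
    have h1 := (Real.Gamma_pos_of_pos (s := γ + 1 + k) (by linarith)).ne'
    have hd : β + γ + 1 + 2 * k ≠ 0 := by
      rcases k with _ | k
      · simpa using hbg
      · have : (0 : ℝ) ≤ k := k.cast_nonneg
        push_cast; linarith
    have h3 : Real.Gamma (β + γ + 1 + 2 * k) ≠ 0 := by
      simpa using Gamma_add_natCast_ne_zero (c := β + γ + 1) (by linarith) hbg (2 * k)
    simp only [Nat.sub_self, zero_add, sum_range_one, Nat.choose_self, Nat.cast_zero, add_zero,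
      mul_zero, pow_zero, Nat.cast_one, Nat.factorial_zero]
    rw [Real.Gamma_add_one hd, show (k : ℝ) + γ + 1 = γ + 1 + k by ring]
    generalize β + γ + 1 + 2 * (k : ℝ) = d at *
    field_simp
  · intro m hm
    have hm0 : (0 : ℝ) ≤ m := m.cast_nonneg
    have hmk := mem_range.1 hm
    rw [sum_range_alternating_choose_mul_Gamma_telescope (by omega) (by linarith), mul_zero]
    rcases m with _ | m
    · simpa using hbg
    · have : (0 : ℝ) ≤ m := m.cast_nonneg
      push_cast; linarith

/-- The reflection symmetry of the shifted Jacobi polynomials. -/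
lemma shiftedJacobi_sub {β γ L : ℝ} (hβ : -1 < β) (hγ : -1 < γ)
    (hbg : β + γ + 1 ≠ 0) (hL : L ≠ 0) (j : ℕ) (x : ℝ) :
    shiftedJacobi L β γ j (L - x) = (-1 : ℝ) ^ j * shiftedJacobi L γ β j x := by
  have hpow : ∀ i : ℕ, (L - x) ^ i =
      ∑ m ∈ range (i + 1), (-1 : ℝ) ^ m * x ^ m * L ^ (i - m) * (i.choose m) := fun i => by
    rw [sub_eq_neg_add, add_pow]
    refine sum_congr rfl fun m _ => ?_
    rw [neg_pow]
  simp only [shiftedJacobi, hpow, mul_sum]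
  rw [sum_range_sum_range_eq_sum_range_add]
  refine sum_congr rfl fun m hm => ?_
  obtain ⟨n, rfl⟩ := Nat.exists_eq_add_of_le (Nat.lt_succ_iff.1 (mem_range.1 hm))
  have hm0 : (0 : ℝ) ≤ m := m.cast_nonneg
  have hn0 : (0 : ℝ) ≤ n := n.cast_nonneg
  have he0 : β + γ + 1 + (2 * m + n : ℕ) ≠ 0 := by
    rcases Nat.eq_zero_or_pos (2 * m + n) with h | h
    · rw [h]; simpa using hbg
    · have : (1 : ℝ) ≤ (2 * m + n : ℕ) := by exact_mod_cast h
      linarith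
  have hsum := sum_range_alternating_choose_mul_Gamma_div n
    (e := β + γ + 1 + (2 * m + n : ℕ)) (f := m + γ + 1) (by push_cast; linarith) he0 (by linarith)
  have hprod : ∏ l ∈ range n, (m + γ + 1 - (β + γ + 1 + (2 * m + n : ℕ)) + (l : ℝ)) =
      (-1 : ℝ) ^ n * (Real.Gamma (m + β + 1 + n) / Real.Gamma (m + β + 1)) := by
    rw [← prod_range_sub_eq_Gamma_div n (g := m + β + 1) (by linarith)]
    refine prod_congr rfl fun l _ => ?_
    push_cast; ring
  rw [hprod] at hsum
  have h1 := (Real.Gamma_pos_of_pos (s := m + γ + 1 + n) (by linarith)).ne'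
  have h2 := (Real.Gamma_pos_of_pos (s := m + β + 1) (by linarith)).ne'
  have h3 := Gamma_add_natCast_ne_zero (c := β + γ + 1) (by linarith) hbg (m + n)
  have hL' : L ^ m ≠ 0 := pow_ne_zero _ hL
  rw [Nat.add_sub_cancel_left]
  have key : ∀ s ∈ range (n + 1),
      (-1 : ℝ) ^ (m + n - (m + s)) * Real.Gamma (((m + n : ℕ) : ℝ) + γ + 1) *
        Real.Gamma (((m + n : ℕ) : ℝ) + ((m + s : ℕ) : ℝ) + β + γ + 1) /
        (Real.Gamma (((m + s : ℕ) : ℝ) + γ + 1) * Real.Gamma (((m + n : ℕ) : ℝ) + β + γ + 1) *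
        (Nat.factorial (m + n - (m + s)) : ℝ) * (Nat.factorial (m + s) : ℝ) * L ^ (m + s)) *
        ((-1 : ℝ) ^ m * x ^ m * L ^ (m + s - m) * ((m + s).choose m)) =
      (-1 : ℝ) ^ (m + n) * x ^ m * Real.Gamma (m + γ + 1 + n) /
        (Real.Gamma (β + γ + 1 + (m + n : ℕ)) * n.factorial * m.factorial * L ^ m) *
      ((-1 : ℝ) ^ s * (n.choose s) * (Real.Gamma (β + γ + 1 + (2 * m + n : ℕ) + s) /
        Real.Gamma (m + γ + 1 + s))) := by
    intro s hs
    obtain ⟨t, rfl⟩ := Nat.exists_eq_add_of_le (Nat.lt_succ_iff.1 (mem_range.1 hs))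
    have hs0 : (0 : ℝ) ≤ s := s.cast_nonneg
    have h4 := (Real.Gamma_pos_of_pos (s := m + γ + 1 + s) (by linarith)).ne'
    rw [Nat.add_sub_cancel_left, show m + (s + t) - (m + s) = t by omega, cast_choose_add,
      cast_choose_add,
      show ((m + (s + t) : ℕ) : ℝ) + γ + 1 = m + γ + 1 + (s + t : ℕ) by push_cast; ring,
      show ((m + (s + t) : ℕ) : ℝ) + (m + s : ℕ) + β + γ + 1 =
        β + γ + 1 + (2 * m + (s + t) : ℕ) + s by push_cast; ring,
      show ((m + s : ℕ) : ℝ) + γ + 1 = m + γ + 1 + s by push_cast; ring,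
      show ((m + (s + t) : ℕ) : ℝ) + β + γ + 1 = β + γ + 1 + (m + (s + t) : ℕ) by ring]
    have hsgn : (-1 : ℝ) ^ s * (-1 : ℝ) ^ s = 1 := by rw [← mul_pow]; simp
    have e : (-1 : ℝ) ^ (m + (s + t)) * (-1 : ℝ) ^ s = (-1) ^ m * (-1) ^ t := by
      rw [pow_add, pow_add]
      linear_combination (-1 : ℝ) ^ m * (-1) ^ t * hsgn
    have h5 : ((m + s).factorial : ℝ) ≠ 0 := by positivity
    have h6 : ((s + t).factorial : ℝ) ≠ 0 := by positivity
    rw [pow_add L]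
    field_simp
    linear_combination -(Real.Gamma (β + γ + 1 + (2 * m + (s + t) : ℕ) + s) * x ^ m) * e
  rw [sum_congr rfl key, ← mul_sum, hsum,
    show ((m + n : ℕ) : ℝ) + β + 1 = m + β + 1 + n by push_cast; ring,
    show ((m + n : ℕ) : ℝ) + (m : ℝ) + γ + β + 1 = β + γ + 1 + (2 * m + n : ℕ) by push_cast; ring,
    show ((m + n : ℕ) : ℝ) + γ + β + 1 = β + γ + 1 + (m + n : ℕ) by ring]
  field_simp

/-- The left-sided Riemann–Liouville derivative of a shifted Jacobi polynomial. -/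
lemma iteratedDeriv_two_integral_sub_rpow_mul_shiftedJacobi {β γ L α : ℝ} (hβ : -1 < β)
    (hγ : -1 < γ) (hbg : β + γ + 1 ≠ 0) (hL : L ≠ 0) (hα1 : 1 < α) (hα2 : α < 2) (j : ℕ)
    {x : ℝ} (hx : 0 < x) :
    iteratedDeriv 2 (fun y : ℝ => (1 / Real.Gamma (2 - α)) *
      ∫ ξ in (0:ℝ)..y, (y - ξ) ^ (1 - α) * shiftedJacobi L β γ j ξ) x =
    ∑ k ∈ range (j + 1), ∑ i ∈ range (k + 1),
      Theta α β γ i j k * Upsilon β γ i k * x ^ (-α) * shiftedJacobi L β γ i x := by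
  conv_lhs => simp only [shiftedJacobi]
  rw [iteratedDeriv_two_integral_sub_rpow_mul_sum hα2 hα1 _ _ hx]
  refine sum_congr rfl fun k hk => ?_
  obtain ⟨n, rfl⟩ := Nat.exists_eq_add_of_le (Nat.lt_succ_iff.1 (mem_range.1 hk))
  have hΘ : ∀ i, Theta α β γ i (k + n) k = (-1 : ℝ) ^ i * Theta α β γ 0 (k + n) k := fun i => by
    simp only [Theta, add_assoc i, pow_add (-1 : ℝ) i, zero_add]
    ring
  have hsum : ∑ i ∈ range (k + 1), Theta α β γ i (k + n) k * Upsilon β γ i k * x ^ (-α) *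
      shiftedJacobi L β γ i x = Theta α β γ 0 (k + n) k * x ^ (-α) * (x / L) ^ k := by
    rw [← sum_Upsilon_mul_shiftedJacobi hβ hγ hbg hL k x, mul_sum]
    refine sum_congr rfl fun i _ => ?_
    rw [hΘ i]
    ring
  have hsgn : (-1 : ℝ) ^ (0 + (k + n) + k) = (-1) ^ n := by
    rw [show 0 + (k + n) + k = n + 2 * k by ring, pow_add, pow_mul]
    simp
  rw [hsum, Theta, hsgn, Nat.add_sub_cancel_left, div_pow,
    show 1 + (k : ℝ) = k + 1 by ring, Real.Gamma_nat_eq_factorial,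
    show 1 + β + γ + ((k + n : ℕ) : ℝ) + k = ((k + n : ℕ) : ℝ) + k + β + γ + 1 by ring,
    show 1 + β + γ + ((k + n : ℕ) : ℝ) = ((k + n : ℕ) : ℝ) + β + γ + 1 by ring,
    show 1 + γ + ((k + n : ℕ) : ℝ) = ((k + n : ℕ) : ℝ) + γ + 1 by ring,
    show 1 + γ + (k : ℝ) = k + γ + 1 by ring]
  simp only [div_eq_mul_inv, mul_inv]
  ring

/-- The right-sided Riemann–Liouville derivative of a shifted Jacobi polynomial. -/
lemma iteratedDeriv_two_integral_rpow_sub_mul_shiftedJacobi {β γ L α : ℝ} (hβ : -1 < β)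
    (hγ : -1 < γ) (hbg : β + γ + 1 ≠ 0) (hL : L ≠ 0) (hα1 : 1 < α) (hα2 : α < 2) (j : ℕ)
    {x : ℝ} (hx : x < L) :
    iteratedDeriv 2 (fun y : ℝ => (1 / Real.Gamma (2 - α)) *
      ∫ ξ in y..L, (ξ - y) ^ (1 - α) * shiftedJacobi L β γ j ξ) x =
    ∑ k ∈ range (j + 1), ∑ i ∈ range (k + 1),
      ThetaBar α β γ j k * UpsilonBar β γ i k * (L - x) ^ (-α) * shiftedJacobi L β γ i x := by
  have hbg' : γ + β + 1 ≠ 0 := by rwa [add_comm γ β]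
  have hint : (fun y : ℝ => (1 / Real.Gamma (2 - α)) *
      ∫ ξ in y..L, (ξ - y) ^ (1 - α) * shiftedJacobi L β γ j ξ) =
      fun y => (-1 : ℝ) ^ j * (fun z : ℝ => (1 / Real.Gamma (2 - α)) *
        ∫ ξ in (0:ℝ)..z, (z - ξ) ^ (1 - α) * shiftedJacobi L γ β j ξ) (L - y) := by
    funext y
    have h := intervalIntegral.integral_comp_sub_left (a := 0) (b := L - y)
      (fun ξ : ℝ => (ξ - y) ^ (1 - α) * shiftedJacobi L β γ j ξ) L
    rw [sub_sub_cancel, sub_zero] at h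
    simp only [← h, shiftedJacobi_sub hβ hγ hbg hL]
    simp only [← intervalIntegral.integral_const_mul]
    refine intervalIntegral.integral_congr fun ξ _ => ?_
    rw [show L - ξ - y = L - y - ξ by ring]
    ring
  rw [hint, iteratedDeriv_const_mul_field, iteratedDeriv_comp_const_sub 2
    (fun z : ℝ => (1 / Real.Gamma (2 - α)) *
      ∫ ξ in (0:ℝ)..z, (z - ξ) ^ (1 - α) * shiftedJacobi L γ β j ξ) L]
  simp only [even_two, Even.neg_pow, one_pow, one_smul]
  rw [iteratedDeriv_two_integral_sub_rpow_mul_shiftedJacobi hγ hβ hbg' hL hα1 hα2 j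
    (sub_pos.2 hx), mul_sum]
  refine sum_congr rfl fun k _ => ?_
  rw [mul_sum]
  refine sum_congr rfl fun i _ => ?_
  have hU : UpsilonBar β γ i k = Upsilon γ β i k := by
    rw [UpsilonBar, Upsilon, add_right_comm 2 γ β, add_right_comm 1 γ β,
      add_right_comm (2 + (k : ℝ)) γ β]
  have hsgn : ∀ a : ℕ, (-1 : ℝ) ^ a * (-1 : ℝ) ^ a = 1 := fun a => by rw [← mul_pow]; simp
  have hΘ : (-1 : ℝ) ^ j * Theta α γ β i j k * (-1 : ℝ) ^ i = ThetaBar α β γ j k := by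
    rw [Theta, ThetaBar, add_right_comm 1 γ β, pow_add, pow_add]
    simp only [div_eq_mul_inv]
    linear_combination ((-1 : ℝ) ^ k * Real.Gamma (1 + β + γ + (j : ℝ) + (k : ℝ)) *
      Real.Gamma (1 + β + (j : ℝ)) * Real.Gamma (1 + (k : ℝ)) *
      (Real.Gamma (1 + β + γ + (j : ℝ)) * Real.Gamma (1 + β + (k : ℝ)) *
      Real.Gamma (1 + (k : ℝ) - α) * (Nat.factorial (j - k) : ℝ) * (Nat.factorial k : ℝ))⁻¹) *
      ((-1 : ℝ) ^ i * (-1) ^ i * hsgn j + hsgn i)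
  rw [shiftedJacobi_sub hγ hβ hbg' hL, hU, ← hΘ]
  ring

/-- the analytic form of the Riesz–Feller fractional derivative of order `α`
(`1 < α < 2`) and skewness `θ` (`|θ| ≤ min{α, 2-α}`) of the shifted Jacobi polynomial on
`[0,L]`: `D_θ^α J_{L,j}^{β,γ}(x) = -(c₊ ₀D_x^α + c₋ ₓD_L^α) J_{L,j}^{β,γ}(x)
= Σ_{k=0}^{j} Σ_{i=0}^{k} Ψ_{i,j,k}^{α,β,γ}(x) J_{L,i}^{β,γ}(x)` for every `x ∈ (0,L)`. -/
theorem rieszFeller_deriv_shiftedJacobi (β γ L α θ : ℝ) (hβ : -1 < β) (hγ : -1 < γ)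
    (hbg : β + γ + 1 ≠ 0) (hL : 0 < L) (hα1 : 1 < α) (hα2 : α < 2)
    (hθ : |θ| ≤ min α (2 - α)) (j : ℕ) (x : ℝ) (hx : x ∈ Set.Ioo (0:ℝ) L) :
    -((Real.sin ((α - θ) * Real.pi / 2) / Real.sin (α * Real.pi)) *
        iteratedDeriv 2
          (fun y : ℝ => (1 / Real.Gamma (2 - α)) *
            ∫ ξ in (0:ℝ)..y, (y - ξ) ^ (1 - α) * shiftedJacobi L β γ j ξ) x
      + (Real.sin ((α + θ) * Real.pi / 2) / Real.sin (α * Real.pi)) *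
        iteratedDeriv 2
          (fun y : ℝ => (1 / Real.Gamma (2 - α)) *
            ∫ ξ in y..L, (ξ - y) ^ (1 - α) * shiftedJacobi L β γ j ξ) x)
    = ∑ k ∈ Finset.range (j + 1), ∑ i ∈ Finset.range (k + 1),
        Psi L α θ β γ i j k x * shiftedJacobi L β γ i x := by
  rw [iteratedDeriv_two_integral_sub_rpow_mul_shiftedJacobi hβ hγ hbg hL.ne' hα1 hα2 j hx.1,
    iteratedDeriv_two_integral_rpow_sub_mul_shiftedJacobi hβ hγ hbg hL.ne' hα1 hα2 j hx.2,
    mul_sum, mul_sum, ← sum_add_distrib, ← sum_neg_distrib]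
  refine sum_congr rfl fun k _ => ?_
  rw [mul_sum, mul_sum, ← sum_add_distrib, ← sum_neg_distrib]
  refine sum_congr rfl fun i _ => ?_
  rw [Psi]
  ring
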